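/- Let F be a field of characteristic different from 2. If there exists a finite Galois field extension K/F whose Galois group Gal(K/F) is isomorphic to the quaternion group Q₈ of order 8, then there exists a finite Galois field extension L/F whose Galois group Gal(L/F) is isomorphic to the dihedral group D₄ of order 8. -/

import Mathlib

namespace QD

def dihPermFun : DihedralGroup 4 → Equiv.Perm (ZMod 4)
  | .r i => Equiv.addRight i
  | .sr i => Equiv.subLeft (-i)

def dihPerm : DihedralGroup 4 →* Equiv.Perm (ZMod 4) :=
  MonoidHom.mk' dihPermFun (by
    rintro (i | i) (j | j) <;> refine Equiv.ext fun x => ?_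
    · change x + (i + j) = x + j + i; ring
    · change -(j - i) - x = (-j - x) + i; ring
    · change -(i + j) - x = -i - (x + j); ring
    · change x + (j - i) = -i - (-j - x); ring)

lemma dihPerm_inj : Function.Injective dihPerm := by
  rintro (i | i) (j | j) h
  · have := congrArg (fun f => f 0) h
    simp [dihPerm, dihPermFun] at this
    rw [this]
  · exfalso
    have h0 := congrArg (fun f => f 0) h
    have h1 := congrArg (fun f => f 1) h
    simp [dihPerm, dihPermFun] at h0 h1
    revert h0 h1; revert i j; decide
  · exfalso
    have h0 := congrArg (fun f => f 0) h
    have h1 := congrArg (fun f => f 1) h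
    simp [dihPerm, dihPermFun] at h0 h1
    revert h0 h1; revert i j; decide
  · have := congrArg (fun f => f 0) h
    simp [dihPerm, dihPermFun] at this
    rw [this]

lemma equiv_of_embed {G : Type*} [Group G] (hG : Nat.card G = 8)
    {α : Type*} (hα : Nat.card α = 4) (f : G →* Equiv.Perm α) (hf : Function.Injective f) :
    Nonempty (G ≃* DihedralGroup 4) := by
  have : Finite α := Nat.finite_of_card_ne_zero (by omega)
  have e : α ≃ ZMod 4 := (Finite.card_eq.1 (by rw [hα]; simp)).some
  let f' : G →* Equiv.Perm (ZMod 4) := (Equiv.permCongrHom e).toMonoidHom.comp f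
  have hf' : Function.Injective f' := (Equiv.permCongrHom e).injective.comp hf
  have e1 : G ≃* f'.range := MonoidHom.ofInjective hf'
  have e2 : DihedralGroup 4 ≃* dihPerm.range := MonoidHom.ofInjective dihPerm_inj
  have hc : Nat.card (Equiv.Perm (ZMod 4)) = 24 := by
    rw [Nat.card_perm]; simp [Nat.factorial]
  have hfac : (24 : ℕ).factorization 2 = 3 := by
    rw [Nat.factorization_def _ Nat.prime_two]
    have : (24 : ℕ) = 2 ^ 3 * 3 := by norm_num
    rw [this, padicValNat.mul (by norm_num) (by norm_num), padicValNat.prime_pow]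
    simp [padicValNat.eq_zero_of_not_dvd]
  have : Fact (Nat.Prime 2) := ⟨Nat.prime_two⟩
  let P : Sylow 2 (Equiv.Perm (ZMod 4)) := Sylow.ofCard f'.range (by
    rw [← Nat.card_congr e1.toEquiv, hG, hc, hfac]; norm_num)
  let Q : Sylow 2 (Equiv.Perm (ZMod 4)) := Sylow.ofCard dihPerm.range (by
    rw [← Nat.card_congr e2.toEquiv, DihedralGroup.nat_card, hc, hfac]; norm_num)
  exact ⟨e1.trans ((Sylow.equiv P Q).trans e2.symm)⟩

lemma sign_elt {F L : Type*} [Field F] [Field L] [Algebra F L] [FiniteDimensional F L]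
    [IsGalois F L] {a : F} (ha : ¬ IsSquare a) {t : L} (ht : t ^ 2 = algebraMap F L a) :
    ∃ g : L ≃ₐ[F] L, g t = - t := by
  by_contra! h
  have : t ∈ (⊥ : IntermediateField F L) := by
    rw [IsGalois.mem_bot_iff_fixed]
    intro g
    have : (g t) ^ 2 = t ^ 2 := by rw [← map_pow, ht, AlgEquiv.commutes]
    exact (sq_eq_sq_iff_eq_or_eq_neg.1 this).resolve_right (h g)
  obtain ⟨c, hc⟩ := IntermediateField.mem_bot.1 this
  apply ha
  refine ⟨c, ?_⟩
  apply (algebraMap F L).injective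
  rw [← ht, ← hc, map_mul, sq]

open Polynomial in
lemma dihedral_of_norm {F : Type*} [Field F] (h2 : (2 : F) ≠ 0) {a b x y : F}
    (ha : ¬ IsSquare a) (hb : ¬ IsSquare b) (hab : ¬ IsSquare (a * b))
    (h : x ^ 2 - a * y ^ 2 = b) (p : F[X]) (hp : p = (X ^ 2 - C x) ^ 2 - C (a * y ^ 2)) :
    IsGalois F p.SplittingField ∧
      Nonempty ((p.SplittingField ≃ₐ[F] p.SplittingField) ≃* DihedralGroup 4) := by
  have hb0 : b ≠ 0 := by rintro rfl; exact hb ⟨0, by simp⟩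
  have ha0 : a ≠ 0 := by rintro rfl; exact ha ⟨0, by simp⟩
  have hy : y ≠ 0 := by rintro rfl; exact hb ⟨x, by rw [← h]; ring⟩
  have hay : a * y ^ 2 ≠ 0 := by positivity
  have hdeg : p.natDegree = 4 := by
    rw [hp]; compute_degree!
  have hp0 : p ≠ 0 := by rintro h0; rw [h0] at hdeg; simp at hdeg
  have hsep : p.Separable := by
    have hd : derivative p = C (4 : F) * (X * (X ^ 2 - C x)) := by
      rw [hp]; simp [derivative_pow]
      rw [show (C (4 : F)) = C 2 * C 2 by rw [← C_mul]; norm_num]; ring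
    have h4 : (4 : F) ≠ 0 := by
      rw [show (4 : F) = 2 * 2 by norm_num]; exact mul_ne_zero h2 h2
    rw [Polynomial.Separable, hd]
    refine IsCoprime.mul_right ?_ (IsCoprime.mul_right ?_ ?_)
    · refine ⟨0, C (4⁻¹), ?_⟩
      rw [zero_mul, zero_add, ← C_mul, inv_mul_cancel₀ h4, C_1]
    · refine ⟨C b⁻¹, - C b⁻¹ * (X ^ 3 - 2 * C x * X), ?_⟩
      have : (C b⁻¹ : F[X]) * (C x ^ 2 - C a * C y ^ 2) = 1 := by
        rw [← C_pow, ← C_pow, ← C_mul, ← C_sub, ← C_mul, h, inv_mul_cancel₀ hb0, C_1]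
      rw [hp, ← this]
      simp only [C_mul, C_pow]
      ring
    · refine ⟨- C (a * y ^ 2)⁻¹, C (a * y ^ 2)⁻¹ * (X ^ 2 - C x), ?_⟩
      have : (C (a * y ^ 2)⁻¹ : F[X]) * C (a * y ^ 2) = 1 := by
        rw [← C_mul, inv_mul_cancel₀ hay, C_1]
      rw [hp]
      linear_combination this
  have hgal : IsGalois F p.SplittingField := IsGalois.of_separable_splitting_field hsep
  refine ⟨hgal, ?_⟩
  have hspl := SplittingField.splits p
  let i := algebraMap F p.SplittingField
  have hi2 : (2 : p.SplittingField) ≠ 0 := by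
    have := (map_ne_zero i).2 h2
    rwa [map_ofNat] at this
  obtain ⟨u, hu⟩ : ∃ u : p.SplittingField, aeval u p = 0 := by
    obtain ⟨u, hu⟩ := hspl.exists_eval_eq_zero (by
      rw [degree_map, degree_eq_natDegree hp0, hdeg]; norm_num)
    exact ⟨u, by rwa [aeval_def, ← eval_map]⟩
  have hroot : ∀ z : p.SplittingField, aeval z p = (z ^ 2 - i x) ^ 2 - i a * i y ^ 2 := by
    intro z; refine (congrArg (aeval z) hp).trans ?_; simp [i]
  rw [hroot] at hu
  have hiy : i y ≠ 0 := (map_ne_zero i).2 hy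
  have hia : i a ≠ 0 := (map_ne_zero i).2 ha0
  have hib : i b ≠ 0 := (map_ne_zero i).2 hb0
  have hib' : i x ^ 2 - i a * i y ^ 2 = i b := by rw [← h]; simp
  obtain ⟨t, ht⟩ : ∃ t, u ^ 2 = i x + i y * t := ⟨(u ^ 2 - i x) / i y, by field_simp; ring⟩
  have hta : t ^ 2 = i a := by
    rw [ht] at hu
    have : i y ^ 2 * (t ^ 2 - i a) = 0 := by linear_combination hu
    have := (mul_eq_zero.1 this).resolve_left (pow_ne_zero _ hiy)
    linear_combination this
  have ht0 : t ≠ 0 := by rintro rfl; apply hia; rw [← hta]; simp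
  obtain ⟨v, hv⟩ : ∃ v, v ^ 2 = i x - i y * t := by
    have hdvd : (X ^ 2 - C (i x - i y * t)) ∣ p.map i := by
      refine ⟨X ^ 2 - C (i x + i y * t), ?_⟩
      refine (congrArg (Polynomial.map i) hp).trans ?_
      have : (C (i a) : p.SplittingField[X]) = C t ^ 2 := by rw [← hta, C_pow]
      simp [this]
      ring
    have hq := hspl.of_dvd (Polynomial.map_ne_zero hp0) hdvd
    obtain ⟨v, hv⟩ := hq.exists_eval_eq_zero (by
      rw [degree_X_pow_sub_C (by norm_num)]; norm_num)
    refine ⟨v, ?_⟩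
    simp at hv
    linear_combination hv
  have huv : (u * v) ^ 2 = i b := by
    rw [mul_pow, ht, hv, ← hib', ← hta]; ring
  have huv0 : u * v ≠ 0 := by intro h0; rw [h0] at huv; apply hib; rw [← huv]; simp
  have hu0 := left_ne_zero_of_mul huv0
  have hv0 := right_ne_zero_of_mul huv0
  have hext : ∀ g k : p.SplittingField ≃ₐ[F] p.SplittingField, g u = k u → g v = k v → g = k := by
    intro g k h1 h2
    refine Gal.ext (p := p) (σ := g) (τ := k) ?_
    intro z hz
    have hz := (mem_rootSet.1 hz).2
    rw [hroot, ← hta] at hz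
    have : (z ^ 2 - u ^ 2) * (z ^ 2 - v ^ 2) = 0 := by rw [ht, hv]; linear_combination hz
    rcases mul_eq_zero.1 this with h | h
    · rcases sq_eq_sq_iff_eq_or_eq_neg.1 (sub_eq_zero.1 h) with rfl | rfl
      · exact h1
      · change g (-_) = k (-_)
        rw [map_neg, map_neg, h1]
    · rcases sq_eq_sq_iff_eq_or_eq_neg.1 (sub_eq_zero.1 h) with rfl | rfl
      · exact h2
      · change g (-_) = k (-_)
        rw [map_neg, map_neg, h2]
  have hgi : ∀ (g : p.SplittingField ≃ₐ[F] p.SplittingField) c, g (i c) = i c :=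
    fun g c => g.commutes c
  have hgt : ∀ g : p.SplittingField ≃ₐ[F] p.SplittingField, g t = t ∨ g t = -t := by
    intro g
    apply sq_eq_sq_iff_eq_or_eq_neg.1
    rw [← map_pow, hta, hgi]
  have hgn : ∀ g : p.SplittingField ≃ₐ[F] p.SplittingField,
      g (u * v) = u * v ∨ g (u * v) = -(u * v) := by
    intro g
    apply sq_eq_sq_iff_eq_or_eq_neg.1
    rw [← map_pow, huv, hgi]
  have hsame : ∀ g : p.SplittingField ≃ₐ[F] p.SplittingField, g t = t →
      (g u = u ∨ g u = -u) ∧ (g v = v ∨ g v = -v) := by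
    intro g hg
    constructor
    · apply sq_eq_sq_iff_eq_or_eq_neg.1
      rw [← map_pow, ht, map_add, map_mul, hg, hgi, hgi]
    · apply sq_eq_sq_iff_eq_or_eq_neg.1
      rw [← map_pow, hv, map_sub, map_mul, hg, hgi, hgi]
  have hdiff : ∀ g : p.SplittingField ≃ₐ[F] p.SplittingField, g t = -t →
      (g u = v ∨ g u = -v) ∧ (g v = u ∨ g v = -u) := by
    intro g hg
    constructor
    · apply sq_eq_sq_iff_eq_or_eq_neg.1
      rw [← map_pow, ht, hv, map_add, map_mul, hg, hgi, hgi]; ring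
    · apply sq_eq_sq_iff_eq_or_eq_neg.1
      rw [← map_pow, ht, hv, map_sub, map_mul, hg, hgi, hgi]; ring
  -- exponent 4
  have hexp : ∀ g : p.SplittingField ≃ₐ[F] p.SplittingField, g ^ 4 = 1 := by
    intro g
    apply hext
    · change g (g (g (g u))) = u
      rcases hgt g with hg | hg
      · rcases (hsame g hg).1 with h1 | h1 <;> simp [h1]
      · rcases hdiff g hg with ⟨h1 | h1, h2 | h2⟩ <;> simp [h1, h2]
    · change g (g (g (g v))) = v
      rcases hgt g with hg | hg
      · rcases (hsame g hg).2 with h1 | h1 <;> simp [h1]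
      · rcases hdiff g hg with ⟨h1 | h1, h2 | h2⟩ <;> simp [h1, h2]
  -- noncommuting elements
  obtain ⟨g, k, hg1, hg2, hk1, hk2⟩ : ∃ g k : p.SplittingField ≃ₐ[F] p.SplittingField,
      g t = -t ∧ g (u * v) = u * v ∧ k t = t ∧ k (u * v) = -(u * v) := by
    obtain ⟨g1, h1⟩ := sign_elt ha hta
    obtain ⟨g2, h2⟩ := sign_elt hb huv
    obtain ⟨g3, h3⟩ := sign_elt hab (t := t * (u * v)) (by rw [mul_pow, hta, huv]; simp [i])
    have hne : t * (u * v) ≠ 0 := mul_ne_zero ht0 huv0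
    have hself : ∀ z : p.SplittingField, z ≠ 0 → z ≠ -z := by
      intro z hz hzz
      have : 2 * z = 0 := by linear_combination hzz
      exact (mul_ne_zero hi2 hz) this
    generalize u * v = n at *
    rw [map_mul] at h3
    rcases hgt g3 with ha3 | ha3 <;> rcases hgn g3 with hb3 | hb3
    · rw [ha3, hb3] at h3; exact absurd h3 (hself _ hne)
    · rcases hgn g1 with hb1 | hb1
      · exact ⟨g1, g3, h1, hb1, ha3, hb3⟩
      · exact ⟨g1 * g3, g3, by simp [ha3, h1], by simp [hb3, hb1], ha3, hb3⟩
    · rcases hgt g2 with ha1 | ha1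
      · exact ⟨g3, g2, ha3, hb3, ha1, h2⟩
      · exact ⟨g3, g2 * g3, ha3, hb3, by simp [ha3, ha1], by simp [hb3, h2]⟩
    · rw [ha3, hb3] at h3; exact absurd (by linear_combination h3) (hself _ hne)
  have hself : ∀ z : p.SplittingField, z ≠ 0 → z ≠ -z := by
    intro z hz hzz
    have : 2 * z = 0 := by linear_combination hzz
    exact (mul_ne_zero hi2 hz) this
  have hnc : g * k ≠ k * g := by
    intro hc
    have hcu : g (k u) = k (g u) := congrArg (fun f => f u) hc
    rw [map_mul] at hg2 hk2
    have A := hself v hv0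
    have B := hself _ huv0
    rcases hdiff g hg1 with ⟨h1 | h1, h2 | h2⟩ <;>
      rcases hsame k hk1 with ⟨h3 | h3, h4 | h4⟩ <;>
      simp only [h1, h2, h3, h4, map_neg, neg_neg, mul_neg, neg_mul] at hcu hg2 hk2 <;>
      first
      | exact A hcu
      | exact A hcu.symm
      | exact B hk2
      | exact B hg2.symm
  have hcardroot : Nat.card (p.rootSet p.SplittingField) = 4 := by
    rw [Nat.card_eq_fintype_card, card_rootSet_eq_natDegree hsep hspl, hdeg]
  have : Fact ((p.map (algebraMap F p.SplittingField)).Splits) := ⟨hspl⟩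
  have hinj := Gal.galActionHom_injective p p.SplittingField
  have : Fact (Nat.Prime 2) := ⟨Nat.prime_two⟩
  have hcard : Nat.card (p.SplittingField ≃ₐ[F] p.SplittingField) = 8 := by
    have hdvd : Nat.card (p.SplittingField ≃ₐ[F] p.SplittingField) ∣ 24 := by
      have := Subgroup.card_dvd_of_injective _ hinj
      rw [Nat.card_perm, hcardroot] at this
      exact this
    have hpg : IsPGroup 2 (p.SplittingField ≃ₐ[F] p.SplittingField) :=
      fun g => ⟨2, hexp g⟩
    obtain ⟨m, hm⟩ := IsPGroup.iff_card.1 hpg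
    rw [hm] at hdvd
    have hm4 : m < 4 := by
      by_contra! hge
      have : 2 ^ 4 ∣ 24 := (pow_dvd_pow 2 hge).trans hdvd
      norm_num at this
    interval_cases m
    · exfalso
      have := (Nat.card_eq_one_iff_unique.1 (hm.trans (by norm_num))).1
      exact hnc (Subsingleton.elim _ _)
    · exfalso
      have := isCyclic_of_prime_card (p := 2) (hm.trans (by norm_num))
      exact hnc ((IsCyclic.isMulCommutative (α := p.SplittingField ≃ₐ[F] p.SplittingField)).is_comm.comm g k)
    · exfalso
      have := IsPGroup.isMulCommutative_of_card_eq_prime_sq hm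
      exact hnc (this.is_comm.comm g k)
    · exact hm
  exact equiv_of_embed hcard hcardroot _ hinj

/-- an element fixed by `j` and negated by `s` -/
lemma exists_delta {F K : Type*} [Field F] [Field K] [Algebra F K] [FiniteDimensional F K]
    [IsGalois F K] (j s : K ≃ₐ[F] K) (h1 : j * s * j = s) (h2 : s * s = j * j)
    (hs : s ∉ Subgroup.zpowers j) : ∃ d : K, d ≠ 0 ∧ j d = d ∧ s d = -d := by
  rw [← IntermediateField.fixingSubgroup_fixedField (Subgroup.zpowers j)] at hs
  rw [IntermediateField.mem_fixingSubgroup_iff] at hs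
  push Not at hs
  obtain ⟨z, hz, hsz⟩ := hs
  have hjz : j z = z := by
    rw [IntermediateField.mem_fixedField_iff] at hz
    exact hz j (Subgroup.mem_zpowers j)
  have e1 : j (s (j z)) = s z := congrArg (fun f => f z) h1
  have e2 : s (s z) = j (j z) := congrArg (fun f => f z) h2
  rw [hjz] at e1
  rw [hjz, hjz] at e2
  refine ⟨z - s z, sub_ne_zero.2 (Ne.symm hsz), ?_, ?_⟩
  · rw [map_sub, hjz, e1]
  · rw [map_sub, e2]; ring

lemma not_sq {F K : Type*} [Field F] [Field K] [Algebra F K] (h2 : (2 : K) ≠ 0)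
    (g : K ≃ₐ[F] K) {d : K} (hd : d ≠ 0) (hg : g d = -d) {a : F}
    (ha : algebraMap F K a = d ^ 2) : ¬ IsSquare a := by
  rintro ⟨c, rfl⟩
  rw [map_mul, ← sq] at ha
  have hz : d = -d := by
    rcases sq_eq_sq_iff_eq_or_eq_neg.1 ha with h | h
    · rw [← h, AlgEquiv.commutes] at hg
      rw [← h]; exact hg
    · have : d = - algebraMap F K c := by rw [h]; ring
      rw [this, map_neg, AlgEquiv.commutes] at hg
      rw [this]; exact hg
  have : 2 * d = 0 := by linear_combination hz
  exact mul_ne_zero h2 hd this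

lemma exists_norm {F K : Type*} [Field F] [Field K] [Algebra F K] [FiniteDimensional F K]
    [IsGalois F K] (hF2 : (2 : F) ≠ 0) (j s : K ≃ₐ[F] K)
    (h1 : j * s * j = s) (h1' : s * j * s = j) (h2 : s * s = j * j)
    (h4 : j * j * (j * j) = 1) (hj : j * j ≠ 1)
    (hs : s ∉ Subgroup.zpowers j) (hs' : j ∉ Subgroup.zpowers s)
    (hfix : ∀ z : K, j z = z → s z = z → ∃ c : F, algebraMap F K c = z) :
    ∃ a b x y : F, ¬ IsSquare a ∧ ¬ IsSquare b ∧ ¬ IsSquare (a * b) ∧ x ^ 2 - a * y ^ 2 = b := by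
  have hK2 : (2 : K) ≠ 0 := by
    have := (map_ne_zero (algebraMap F K)).2 hF2
    rwa [map_ofNat] at this
  have key : ∀ d n : K, d ≠ 0 → n ≠ 0 → j d = d → s d = -d → j n = -n → s n = n →
      ∃ a b : F, algebraMap F K a = d ^ 2 ∧ algebraMap F K b = n ^ 2 ∧
        ¬ IsSquare a ∧ ¬ IsSquare b ∧ ¬ IsSquare (a * b) := by
    intro d n hd hn jd sd jn sn
    obtain ⟨a, ha⟩ := hfix (d ^ 2) (by rw [map_pow, jd]) (by rw [map_pow, sd]; ring)
    obtain ⟨b, hb⟩ := hfix (n ^ 2) (by rw [map_pow, jn]; ring) (by rw [map_pow, sn])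
    refine ⟨a, b, ha, hb, not_sq hK2 s hd sd ha, not_sq hK2 j hn jn hb,
      not_sq hK2 s (mul_ne_zero hd hn) (by rw [map_mul, sd, sn]; ring)
        (by rw [map_mul, ha, hb]; ring)⟩
  by_cases hm1 : IsSquare (-1 : F)
  · obtain ⟨i0, hi0⟩ := hm1
    have J4 : ∀ z, j (j (j (j z))) = z := fun z => congrArg (fun f => f z) h4
    have E1 : ∀ z, j (s (j z)) = s z := fun z => congrArg (fun f => f z) h1
    have E2 : ∀ z, s (s z) = j (j z) := fun z => congrArg (fun f => f z) h2
    obtain ⟨i, g, hi, ji, si, hg, jg⟩ : ∃ i g : K, i ^ 2 = -1 ∧ j i = i ∧ s i = i ∧ g ≠ 0 ∧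
        j g = i * g := by
      have hi : (algebraMap F K i0) ^ 2 = -1 := by rw [sq, ← map_mul, ← hi0]; simp
      have ji := j.commutes i0
      have si := s.commutes i0
      generalize algebraMap F K i0 = i at *
      obtain ⟨z, hz⟩ : ∃ z, j (j z) ≠ z := by
        by_contra! h
        exact hj (AlgEquiv.ext h)
      have hw : z - j (j z) ≠ 0 := sub_ne_zero.2 hz.symm
      have jw : j (j (z - j (j z))) = -(z - j (j z)) := by
        rw [map_sub, map_sub, J4]; ring
      generalize z - j (j z) = w at *
      by_cases hw' : w - i * j w = 0
      · refine ⟨-i, w, by rw [neg_sq, hi], by rw [map_neg, ji], by rw [map_neg, si], hw, ?_⟩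
        linear_combination i * hw' + j w * hi
      · refine ⟨i, w - i * j w, hi, ji, si, hw', ?_⟩
        rw [map_sub, map_mul, ji, jw]
        linear_combination (j w) * hi
    have hi0' : i ≠ 0 := by rintro rfl; norm_num at hi
    have jjg : j (j g) = -g := by
      rw [jg, map_mul, ji, jg]; linear_combination g * hi
    have hsg : s g ≠ 0 := by simpa using hg
    have jsg : j (s g) = -i * s g := by
      have := E1 g
      rw [jg, map_mul, map_mul, si, ji] at this
      linear_combination (-i) * this + j (s g) * hi
    have ssg : s (s g) = -g := by rw [E2, jjg]
    -- δ = g * s g, ν = g^2 + (s g)^2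
    have hd0 : g * s g ≠ 0 := mul_ne_zero hg hsg
    have jd : j (g * s g) = g * s g := by
      rw [map_mul, jg, jsg]; linear_combination (-g * s g) * hi
    have sd : s (g * s g) = -(g * s g) := by
      rw [map_mul, ssg]; ring
    have jn : j (g ^ 2 + s g ^ 2) = -(g ^ 2 + s g ^ 2) := by
      rw [map_add, map_pow, map_pow, jg, jsg]
      linear_combination (g ^ 2 + s g ^ 2) * hi
    have sn : s (g ^ 2 + s g ^ 2) = g ^ 2 + s g ^ 2 := by
      rw [map_add, map_pow, map_pow, ssg]; ring
    have hn0 : g ^ 2 + s g ^ 2 ≠ 0 := by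
      intro h0
      have hh : (s g) ^ 2 = (i * g) ^ 2 := by
        rw [mul_pow, hi]; linear_combination h0
      rcases sq_eq_sq_iff_eq_or_eq_neg.1 hh with h | h
      · rw [h, map_mul, ji, jg] at jsg
        have : 2 * (i ^ 2 * g) = 0 := by linear_combination jsg
        rw [hi] at this
        exact mul_ne_zero hK2 (mul_ne_zero (by norm_num) hg) this
      · rw [h, map_neg, map_mul, ji, jg] at jsg
        have : 2 * (i ^ 2 * g) = 0 := by linear_combination -jsg
        rw [hi] at this
        exact mul_ne_zero hK2 (mul_ne_zero (by norm_num) hg) this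
    obtain ⟨a, b, ha, hb, hna, hnb, hnab⟩ := key _ _ hd0 hn0 jd sd jn sn
    generalize hdd : g * s g = d at *
    generalize hnn : g ^ 2 + s g ^ 2 = n at *
    -- e = i δ ν / g^2
    obtain ⟨e, he⟩ : ∃ e, e = i * d * n / g ^ 2 := ⟨_, rfl⟩
    have je : j e = e := by
      rw [he, map_div₀, map_mul, map_mul, map_pow, ji, jd, jn, jg, mul_pow, hi]
      field_simp
    have se : s e = - (i * d * n / (s g) ^ 2) := by
      rw [he, map_div₀, map_mul, map_mul, map_pow, si, sd, sn]
      field_simp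
    have sse : s (s e) = e := by rw [E2, je, je]
    have jse : j (s e) = s e := by
      have := E1 e
      rwa [je] at this
    have hnorm : e * s e = n ^ 2 := by
      rw [se, he]
      have : i * d * n / g ^ 2 * -(i * d * n / s g ^ 2) =
        -(i ^ 2) * n ^ 2 * d ^ 2 / (g * s g) ^ 2 := by field_simp
      rw [this, hdd, hi]
      field_simp
    obtain ⟨x, hx⟩ := hfix ((e + s e) / 2)
      (by rw [map_div₀, map_add, je, jse, map_ofNat])
      (by rw [map_div₀, map_add, sse, map_ofNat, add_comm])
    obtain ⟨y, hy⟩ := hfix ((e - s e) / (2 * d))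
      (by rw [map_div₀, map_sub, je, jse, map_mul, jd, map_ofNat])
      (by rw [map_div₀, map_sub, sse, map_mul, sd, map_ofNat]; field_simp; ring)
    refine ⟨a, b, x, y, hna, hnb, hnab, ?_⟩
    apply (algebraMap F K).injective
    rw [map_sub, map_mul, map_pow, map_pow, hx, hy, ha, hb, ← hnorm]
    field_simp
    ring
  · obtain ⟨d, hd, jd, sd⟩ := exists_delta j s h1 h2 hs
    obtain ⟨n, hn, sn, jn⟩ := exists_delta s j h1' h2.symm hs'
    obtain ⟨a, b, ha, hb, hna, hnb, hnab⟩ := key d n hd hn jd sd jn sn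
    have aux : ∀ a : F, ¬ IsSquare a → ¬ IsSquare (-a) → ∃ a b x y : F, ¬ IsSquare a ∧
        ¬ IsSquare b ∧ ¬ IsSquare (a * b) ∧ x ^ 2 - a * y ^ 2 = b := by
      intro a h h'
      refine ⟨a, -a, 0, 1, h, h', ?_, by ring⟩
      rintro ⟨c, hc⟩
      have ha0 : a ≠ 0 := by rintro rfl; exact h ⟨0, by simp⟩
      apply hm1
      refine ⟨c / a, ?_⟩
      field_simp
      linear_combination hc
    by_cases h : IsSquare (-a)
    · refine aux b hnb fun h' => hnab ?_
      have := h.mul h'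
      rwa [neg_mul_neg] at this
    · exact aux a hna h

end QD



/-- Let `F` be a field of characteristic `≠ 2`.  If there is a finite Galois extension
`K/F` with `Gal(K/F)` isomorphic to the quaternion group `Q₈` of order `8`, then there is a
finite Galois extension `L/F` with `Gal(L/F)` isomorphic to the dihedral group `D₄` of
order `8`. -/
theorem quaternion_realizable_implies_dihedral_realizable.{u}
    (F : Type u) [Field F] (hchar : ringChar F ≠ 2)
    (hQ : ∃ (K : Type u) (_ : Field K) (_ : Algebra F K), FiniteDimensional F K ∧
      IsGalois F K ∧ Nonempty ((K ≃ₐ[F] K) ≃* QuaternionGroup 2)) :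
    ∃ (L : Type u) (_ : Field L) (_ : Algebra F L), FiniteDimensional F L ∧
      IsGalois F L ∧ Nonempty ((L ≃ₐ[F] L) ≃* DihedralGroup 4) := by
  classical
  obtain ⟨K, _, _, hfd, hgal, ⟨e⟩⟩ := hQ
  have hF2 : (2 : F) ≠ 0 := Ring.two_ne_zero hchar
  have hmem : ∀ g h : QuaternionGroup 2, (∀ k : ZMod 4, g ≠ h ^ (k.val)) → h ^ 4 = 1 →
      e.symm g ∉ Subgroup.zpowers (e.symm h) := by
    intro g h hk h4 hm
    obtain ⟨k, hk'⟩ := Subgroup.mem_zpowers_iff.1 hm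
    rw [← map_zpow] at hk'
    have hk'' := e.symm.injective hk'
    apply hk (k : ZMod 4)
    rw [← hk'', ← zpow_natCast, ZMod.val_intCast]
    conv_lhs => rw [← Int.mul_ediv_add_emod k 4]
    rw [zpow_add, zpow_mul]
    have : h ^ (4 : ℤ) = 1 := by exact_mod_cast h4
    rw [this, one_zpow, one_mul]
    rfl
  obtain ⟨a, b, x, y, ha, hb, hab, h⟩ := QD.exists_norm hF2
    (e.symm (QuaternionGroup.a 1)) (e.symm (QuaternionGroup.xa 0))
    (by simp only [← map_mul]; congr 1) (by simp only [← map_mul]; congr 1)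
    (by simp only [← map_mul]; congr 1)
    (by simp only [← map_mul]; rw [← map_one e.symm]; congr 1)
    (by
      simp only [← map_mul]; rw [← map_one e.symm]
      exact fun h => absurd (e.symm.injective h) (by decide))
    (hmem _ _ (by decide) (by decide)) (hmem _ _ (by decide) (by decide))
    (by
      intro z hj hs
      have hpow : ∀ n : ℕ, ((e.symm (QuaternionGroup.a 1)) ^ n) z = z := by
        intro n
        induction n with
        | zero => simp
        | succ n ih => rw [pow_succ, AlgEquiv.mul_apply, hj, ih]
      have : z ∈ (⊥ : IntermediateField F K) := by
        rw [IsGalois.mem_bot_iff_fixed]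
        intro g
        have hcl : ∀ q : QuaternionGroup 2, ∃ k : ZMod 4, q = QuaternionGroup.a 1 ^ k.val ∨
          q = QuaternionGroup.xa 0 * QuaternionGroup.a 1 ^ k.val := by decide
        obtain ⟨k, hk | hk⟩ := hcl (e g)
        · have : g = e.symm (QuaternionGroup.a 1) ^ k.val := by
            rw [← map_pow, ← hk]; simp
          rw [this, hpow]
        · have : g = e.symm (QuaternionGroup.xa 0) * e.symm (QuaternionGroup.a 1) ^ k.val := by
            rw [← map_pow, ← map_mul, ← hk]; simp
          rw [this, AlgEquiv.mul_apply, hpow, hs]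
      obtain ⟨c, hc⟩ := IntermediateField.mem_bot.1 this
      exact ⟨c, hc⟩)
  have := QD.dihedral_of_norm hF2 ha hb hab h _ rfl
  exact ⟨_, inferInstance, inferInstance, inferInstance, this.1, this.2⟩
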